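/- arXiv:2006.15689 — 2 statements merged into one kernel-verified Lean document; each statement's English description precedes it below -/
import Mathlib

section
/- Let n ≥ 1, let s_1, …, s_n be real numbers, and define the empirical distribution function F̂(x) = (1/n)·#{ i : s_i ≤ x }; write F̂(x⁻) for the left limit of F̂ at x. Let G : ℝ → ℝ be nondecreasing, right-continuous, with 0 ≤ G(x) ≤ 1 for all x, and let ε ≥ 0. If for every i ∈ {1, …, n} one has F̂(s_i) − ε ≤ G(s_i) and G(s_i) ≤ F̂(s_i⁻) + ε, then sup_{x ∈ ℝ} |G(x) − F̂(x)| ≤ ε. -/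
open Finset

/-- Sufficiency of the paper's finitely many linear constraints (Eq. (10)) for the
Kolmogorov–Smirnov constraint (Eq. (8)): if the candidate distribution function `G`
(nondecreasing, right-continuous, with values in `[0,1]`) satisfies
`F̂(sᵢ) - ε ≤ G(sᵢ) ≤ F̂(sᵢ⁻) + ε` at every data point `sᵢ`, then
`sup_x |G x - F̂ x| ≤ ε`, where `F̂` is the empirical distribution function of the data
and `F̂(x⁻)` its left limit at `x`. -/
theorem stmt_4 (n : ℕ) (hn : 1 ≤ n) (s : Fin n → ℝ)
    (Fhat : ℝ → ℝ)
    (hFhat : ∀ x, Fhat x = ((univ.filter fun i => s i ≤ x).card : ℝ) / n)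
    (G : ℝ → ℝ) (hGmono : Monotone G)
    (hGrc : ∀ x, ContinuousWithinAt G (Set.Ici x) x)
    (hG01 : ∀ x, 0 ≤ G x ∧ G x ≤ 1)
    (ε : ℝ) (hε : 0 ≤ ε)
    (hconstr : ∀ i : Fin n,
      Fhat (s i) - ε ≤ G (s i) ∧ G (s i) ≤ Function.leftLim Fhat (s i) + ε) :
    ∀ x : ℝ, |G x - Fhat x| ≤ ε := by
  intro x
  have hn' : (0 : ℝ) < n := by exact_mod_cast hn
  have hconst : ∀ y z, (∀ i, s i ≤ y ↔ s i ≤ z) → Fhat y = Fhat z := by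
    intro y z h
    simp only [hFhat, h]
  rw [abs_sub_le_iff]
  constructor
  · rcases (univ.filter fun i => x < s i).eq_empty_or_nonempty with hempty | hne
    · have hle : ∀ i, s i ≤ x := fun i =>
        not_lt.1 (Finset.filter_eq_empty_iff.1 hempty (mem_univ i))
      have hone : Fhat x = 1 := by
        simp [hFhat, hle, hn'.ne']
      linarith [(hG01 x).2]
    · obtain ⟨j, hj, hmin⟩ := Finset.exists_min_image _ s hne
      simp only [mem_filter, mem_univ, true_and] at hj hmin
      have hlim : Function.leftLim Fhat (s j) = Fhat x := by
        apply leftLim_eq_of_tendsto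
        refine tendsto_const_nhds.congr' ?_
        filter_upwards [Ioo_mem_nhdsLT hj] with y hy
        refine hconst x y fun i => ⟨fun h => h.trans hy.1.le, fun h => ?_⟩
        by_contra! hi
        exact absurd (hmin i hi) (not_le.2 (h.trans_lt hy.2))
      linarith [(hconstr j).2, hGmono hj.le]
  · rcases (univ.filter fun i => s i ≤ x).eq_empty_or_nonempty with hempty | hne
    · have hzero : Fhat x = 0 := by simp [hFhat, hempty]
      linarith [(hG01 x).1]
    · obtain ⟨j, hj, hmax⟩ := Finset.exists_max_image _ s hne
      simp only [mem_filter, mem_univ, true_and] at hj hmax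
      have heq : Fhat x = Fhat (s j) :=
        hconst x (s j) fun i => ⟨hmax i, fun h => h.trans hj⟩
      linarith [(hconstr j).1, hGmono hj]
end

section
/- Let n ≥ 1, let s_1, …, s_n be real numbers, and define the empirical distribution function F̂(x) = (1/n)·#{ i : s_i ≤ x }; write F̂(x⁻) for the left limit of F̂ at x. Let G : ℝ → ℝ be nondecreasing, right-continuous, with 0 ≤ G(x) ≤ 1 for all x, and suppose G is continuous at each point s_i, i ∈ {1, …, n}. Then for every ε ≥ 0: sup_{x ∈ ℝ} |G(x) − F̂(x)| ≤ ε holds if and only if for every i ∈ {1, …, n}, F̂(s_i) − ε ≤ G(s_i) and G(s_i) ≤ F̂(s_i⁻) + ε. -/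
open Finset

/-- The paper's claimed equivalence between the Kolmogorov–Smirnov constraint (Eq. (8)),
`sup_x |G x - F̂ x| ≤ ε`, and the finite system of linear constraints (Eq. (10)) at the
data points, valid when the candidate distribution function `G` (nondecreasing,
right-continuous, with values in `[0,1]`) is continuous at each data point `sᵢ`.
Here `F̂` is the empirical distribution function of the data and `F̂(x⁻)` its left
limit at `x`. -/
theorem stmt_5 (n : ℕ) (hn : 1 ≤ n) (s : Fin n → ℝ)
    (Fhat : ℝ → ℝ)
    (hFhat : ∀ x, Fhat x = ((univ.filter fun i => s i ≤ x).card : ℝ) / n)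
    (G : ℝ → ℝ) (hGmono : Monotone G)
    (hGrc : ∀ x, ContinuousWithinAt G (Set.Ici x) x)
    (hG01 : ∀ x, 0 ≤ G x ∧ G x ≤ 1)
    (hGcont : ∀ i : Fin n, ContinuousAt G (s i)) :
    ∀ ε : ℝ, 0 ≤ ε →
      ((∀ x : ℝ, |G x - Fhat x| ≤ ε) ↔
        ∀ i : Fin n,
          Fhat (s i) - ε ≤ G (s i) ∧ G (s i) ≤ Function.leftLim Fhat (s i) + ε) := by
  have hn0 : (0 : ℝ) < n := by exact_mod_cast hn
  have hle : ∀ {x y : ℝ}, (∀ i, s i ≤ x → s i ≤ y) → Fhat x ≤ Fhat y := by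
    intro x y h
    rw [hFhat, hFhat]
    have hsub : (univ.filter fun i => s i ≤ x) ⊆ univ.filter fun i => s i ≤ y :=
      fun i hi => by simpa using h i (by simpa using hi)
    gcongr ((card ?_ : ℕ) : ℝ) / n
  have hmono : Monotone Fhat := fun x y hxy => hle fun i hi => hi.trans hxy
  intro ε hε
  constructor
  · intro h i
    refine ⟨by linarith [neg_le_of_abs_le (h (s i))], ?_⟩
    have hG : Filter.Tendsto G (nhdsWithin (s i) (Set.Iio (s i))) (nhds (G (s i))) :=
      (hGcont i).tendsto.mono_left nhdsWithin_le_nhds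
    refine le_of_tendsto hG ?_
    filter_upwards [self_mem_nhdsWithin] with x hx
    linarith [le_of_abs_le (h x), hmono.le_leftLim hx]
  · intro h x
    rw [abs_le]
    constructor
    · rcases (univ.filter fun i => s i ≤ x).eq_empty_or_nonempty with hem | hne
      · have h0 : Fhat x = 0 := by simp [hFhat, hem]
        linarith [(hG01 x).1]
      · obtain ⟨i, hi, hmax⟩ := exists_max_image _ s hne
        have hF : Fhat x ≤ Fhat (s i) := hle fun j hj => hmax j (by simpa using hj)
        linarith [(h i).1, hGmono (mem_filter.mp hi).2]
    · rcases (univ.filter fun i => x < s i).eq_empty_or_nonempty with hem | hne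
      · have hall : ∀ i, s i ≤ x := by simpa [filter_eq_empty_iff] using hem
        have h1 : Fhat x = 1 := by simp [hFhat, hall, hn0.ne']
        linarith [(hG01 x).2]
      · obtain ⟨j, hj, hmin⟩ := exists_min_image _ s hne
        have hxj : x < s j := (mem_filter.mp hj).2
        have hF : Function.leftLim Fhat (s j) ≤ Fhat x := by
          refine le_of_tendsto (hmono.tendsto_leftLim (s j)) ?_
          filter_upwards [self_mem_nhdsWithin] with y hy
          refine hle fun i hi => ?_
          by_contra! hlt
          exact absurd (hmin i (by simpa using hlt)) (not_le.mpr (hi.trans_lt hy))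
        linarith [(h j).2, hGmono hxj.le]
end
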